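/- Optimality Theorem: If there exists some protocol A = (A_1,…,A_N) in which the truthful profile (s^t,…,s^t) is an equilibrium, then (s^t,…,s^t) is also an equilibrium of the competitive protocol F^c. -/

import Mathlib

open scoped Classical
noncomputable section

/-- A strategy of an agent: `(p, q)` with `p = P(mᵢ = 0 ∣ bᵢ = 0)`, `q = P(mᵢ = 0 ∣ bᵢ = 1)`. -/
abbrev Strategy : Type := (Set.Icc (0:ℝ) 1) × (Set.Icc (0:ℝ) 1)

/-- The truthful strategy `sᵗ = (1,0)`. -/
def sT : Strategy := (⟨1, by norm_num⟩, ⟨0, by norm_num⟩)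

/-- A zero-information strategy: `p = q`. -/
def ZeroInfo (s : Strategy) : Prop := (s.1 : ℝ) = (s.2 : ℝ)

/-- Vectors of `N+1` bits (bits of the center and the `N` agents; also used for
message vectors and for the center's replies).  Coordinate `0` is the center. -/
abbrev Bits (N : ℕ) : Type := Fin (N+1) → Bool

/-- A strategy profile of the `N` agents. -/
abbrev Profile (N : ℕ) : Type := Fin N → Strategy

/-- A protocol for a single agent: a map from strategy profiles and message vectors to
distributions over replies `f ∈ {0,1}^{N+1}`. -/
abbrev Protocol (N : ℕ) : Type := Profile N → Bits N → PMF (Bits N)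

/-- `P(message = msg ∣ bit = bit)` under strategy `s` (where `false` plays the role of `0`). -/
def strandP (s : Strategy) (bit msg : Bool) : ℝ :=
  if msg then 1 - (if bit then (s.2 : ℝ) else (s.1 : ℝ))
  else (if bit then (s.2 : ℝ) else (s.1 : ℝ))

/-- `P(messages = m ∣ bits = b)` under profile `s`; the center's message is her own bit. -/
def msgP {N : ℕ} (s : Profile N) (b m : Bits N) : ℝ :=
  (if m 0 = b 0 then (1:ℝ) else 0) * ∏ i : Fin N, strandP (s i) (b i.succ) (m i.succ)

/-- Joint probability of bits `b`, messages `m` and reply `f` (to the relevant agent),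
under profile `s` and protocol `F`; bits are i.i.d. uniform. -/
def jointP {N : ℕ} (s : Profile N) (F : Protocol N) (b m f : Bits N) : ℝ :=
  ((1:ℝ)/2)^(N+1) * msgP s b m * ((F s m) f).toReal

/-- `P(bᵢ = bi, mᵢ = mi, fᵢ = f, g(b) = val)` for agent `i` (coordinate `i.succ`). -/
def pObs {N : ℕ} (g : Bits N → Bool) (s : Profile N) (F : Protocol N) (i : Fin N)
    (bi mi : Bool) (f : Bits N) (val : Bool) : ℝ :=
  ∑ b : Bits N, ∑ m : Bits N,
    if b i.succ = bi ∧ m i.succ = mi ∧ g b = val then jointP s F b m f else 0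

/-- `P(bᵢ = bi, mᵢ = mi, fᵢ = f)` for agent `i`. -/
def pObsAll {N : ℕ} (s : Profile N) (F : Protocol N) (i : Fin N)
    (bi mi : Bool) (f : Bits N) : ℝ :=
  ∑ b : Bits N, ∑ m : Bits N,
    if b i.succ = bi ∧ m i.succ = mi then jointP s F b m f else 0

/-- `P(b_k = 1, bᵢ = bi, mᵢ = mi, fᵢ = f)` for agent `i`. -/
def pBit {N : ℕ} (s : Profile N) (F : Protocol N) (i : Fin N)
    (bi mi : Bool) (f : Bits N) (k : Fin (N+1)) : ℝ :=
  ∑ b : Bits N, ∑ m : Bits N,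
    if b i.succ = bi ∧ m i.succ = mi ∧ b k = true then jointP s F b m f else 0

/-- The posterior `v_k = P(b_k = 1 ∣ fᵢ, mᵢ, bᵢ)` of agent `i` at the realization
`(bi, mi, f)`. -/
def post {N : ℕ} (s : Profile N) (F : Protocol N) (i : Fin N)
    (bi mi : Bool) (f : Bits N) (k : Fin (N+1)) : ℝ :=
  pBit s F i bi mi f k / pObsAll s F i bi mi f

/-- Expected profit `V_i(s⃗; F_i)`: after observing `(bᵢ, mᵢ, fᵢ)` the agent guesses the
more likely value of `g(b)` (uniformly at random in case of a tie) and earns `c i` iff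
the guess is correct. -/
def V {N : ℕ} (g : Bits N → Bool) (c : Fin N → ℝ) (s : Profile N) (F : Protocol N)
    (i : Fin N) : ℝ :=
  c i * ∑ bi : Bool, ∑ mi : Bool, ∑ f : Bits N,
    (if pObs g s F i bi mi f true > pObs g s F i bi mi f false then pObs g s F i bi mi f true
     else if pObs g s F i bi mi f false > pObs g s F i bi mi f true then
       pObs g s F i bi mi f false
     else (pObs g s F i bi mi f false + pObs g s F i bi mi f true) / 2)

/-- Utility `U_i(s⃗; F_i) = V_i(s⃗; F_i) − priceᵢ(sᵢ)`. -/
def U {N : ℕ} (g : Bits N → Bool) (c : Fin N → ℝ) (price : Fin N → Strategy → ℝ)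
    (s : Profile N) (F : Protocol N) (i : Fin N) : ℝ :=
  V g c s F i - price i (s i)

/-- The all-truthful profile `(sᵗ, …, sᵗ)`. -/
def truthProfile (N : ℕ) : Profile N := fun _ => sT

/-- `s⃗` is an equilibrium of the protocol `F = (F_1,…,F_N)`. -/
def Equilibrium {N : ℕ} (g : Bits N → Bool) (c : Fin N → ℝ) (price : Fin N → Strategy → ℝ)
    (s : Profile N) (FF : Fin N → Protocol N) : Prop :=
  ∀ i : Fin N, ∀ s' : Strategy,
    U g c price s (FF i) i ≥ U g c price (Function.update s i s') (FF i) i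

/-- The improvement `F_i⁺` of a protocol `F_i`: it agrees with `F_i` when `s_i` is a
zero-information strategy, and otherwise returns the reply whose first coordinate is
`m₀ = b₀` and whose remaining coordinates are those of `F_i`'s reply. -/
def improve {N : ℕ} (i : Fin N) (F : Protocol N) : Protocol N := fun s m =>
  if ZeroInfo (s i) then F s m
  else PMF.map (fun f => Function.update f 0 (m 0)) (F s m)

/-- The center is helpless. -/
def Helpless (N : ℕ) (g : Bits N → Bool) (c : Fin N → ℝ)
    (price : Fin N → Strategy → ℝ) : Prop :=
  ∀ i : Fin N, ∀ F : Protocol N, ∀ si : Strategy, ¬ ZeroInfo si →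
    ∀ sr : Profile N, (∀ j, ZeroInfo (sr j)) →
      U g c price sr F i ≥ U g c price (Function.update sr i si) (improve i F) i

/-- Relative price `price_i^r(s_i) = price_i(s_i) / price_i(sᵗ)`. -/
def priceR {N : ℕ} (price : Fin N → Strategy → ℝ) (i : Fin N) (s : Strategy) : ℝ :=
  price i s / price i sT

/-- The competitive protocol (the component `F_i^c` for agent `i`). -/
def Fc {N : ℕ} (price : Fin N → Strategy → ℝ) (i : Fin N) : Protocol N := fun s m =>
  if ∀ j, s j = sT then PMF.pure m
  else if ∀ j, j ≠ i → priceR price j (s j) < priceR price i (s i) then PMF.pure m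
  else PMF.uniformOfFintype (Bits N)

/-- The protocol that always replies the full message vector `m = (b₀, m₁, …, m_N)`. -/
def Fmax (N : ℕ) : Protocol N := fun _ m => PMF.pure m

/-- The protocol that always replies `N+1` independent uniform random bits. -/
def Fmin (N : ℕ) : Protocol N := fun _ _ => PMF.uniformOfFintype (Bits N)

/-- Agent `i` is fanatic. -/
def Fanatic {N : ℕ} (g : Bits N → Bool) (c : Fin N → ℝ) (price : Fin N → Strategy → ℝ)
    (i : Fin N) : Prop :=
  ∀ s : Profile N,
    price i sT > V g c (truthProfile N) (Fmax N) i - V g c s (Fmin N) i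

/-- The fair competitive protocol (the component `F_i^{fc}` for agent `i`). -/
def Ffc {N : ℕ} (price : Fin N → Strategy → ℝ) (i : Fin N) : Protocol N := fun s m =>
  if s i = sT then PMF.pure m
  else if (∃ j, j ≠ i ∧ s j ≠ sT) ∧
      (∀ j, j ≠ i → s j ≠ sT → priceR price j (s j) < priceR price i (s i)) then PMF.pure m
  else PMF.uniformOfFintype (Bits N)

/-- The probability that `bᵢ = bi` and `g(b) = val`. -/
def bitMass {N : ℕ} (g : Bits N → Bool) (i : Fin N) (bi val : Bool) : ℝ :=
  ∑ b : Bits N, if b i.succ = bi ∧ g b = val then ((1:ℝ)/2)^(N+1) else 0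

lemma strandP_nonneg (s : Strategy) (bit msg : Bool) : 0 ≤ strandP s bit msg := by
  have h₁ := s.1.2
  have h₂ := s.2.2
  simp only [Set.mem_Icc] at h₁ h₂
  unfold strandP
  split_ifs <;> linarith

lemma sum_strandP (s : Strategy) (bit : Bool) : ∑ msg, strandP s bit msg = 1 := by
  simp [strandP]

lemma strandP_sT (bit msg : Bool) : strandP sT bit msg = if msg = bit then 1 else 0 := by
  cases bit <;> cases msg <;> simp [strandP, sT]

lemma msgP_nonneg {N : ℕ} (s : Profile N) (b m : Bits N) : 0 ≤ msgP s b m :=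
  mul_nonneg (by split_ifs <;> norm_num) (Finset.prod_nonneg fun _ _ => strandP_nonneg _ _ _)

lemma msgP_truthProfile_of_ne {N : ℕ} {b m : Bits N} (h : m ≠ b) :
    msgP (truthProfile N) b m = 0 := by
  obtain ⟨k, hk⟩ := Function.ne_iff.1 h
  unfold msgP
  refine Fin.cases (fun hk => by simp [hk]) (fun j hj => ?_) k hk
  rw [Finset.prod_eq_zero (Finset.mem_univ j), mul_zero]
  simp [truthProfile, strandP_sT, hj]

/-- Given the bits, the message of agent `i` is distributed according to her own strategy. -/
lemma sum_msgP_filter {N : ℕ} (s : Profile N) (b : Bits N) (i : Fin N) (mi : Bool) :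
    (∑ m : Bits N, if m i.succ = mi then msgP s b m else 0) =
      strandP (s i) (b i.succ) mi := by
  let w : Fin (N+1) → Bool → ℝ := Fin.cases (fun x => if x = b 0 then 1 else 0)
    (fun j x => if j = i then (if x = mi then strandP (s j) (b j.succ) x else 0)
      else strandP (s j) (b j.succ) x)
  have hw : ∀ m : Bits N, (if m i.succ = mi then msgP s b m else 0) = ∏ k, w k (m k) := by
    intro m
    rw [Fin.prod_univ_succ]
    simp only [w, Fin.cases_zero, Fin.cases_succ, msgP]
    by_cases hm : m i.succ = mi
    · rw [if_pos hm]
      congr 1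
      refine Finset.prod_congr rfl fun j _ => ?_
      by_cases hj : j = i
      · subst hj; simp [hm]
      · simp [hj]
    · rw [if_neg hm, Finset.prod_eq_zero (Finset.mem_univ i), mul_zero]
      simp [hm]
  have hprod := Finset.prod_univ_sum (fun _ : Fin (N+1) => (Finset.univ : Finset Bool)) w
  rw [Fintype.piFinset_univ] at hprod
  simp_rw [hw]
  rw [← hprod, Fin.prod_univ_succ, Fintype.prod_eq_single i]
  · simp [w]
  · intro j hj
    simp only [w, Fin.cases_succ, if_neg hj]
    exact sum_strandP _ _

lemma PMF.sum_toReal {α : Type*} [Fintype α] (p : PMF α) : ∑ a, (p a).toReal = 1 := by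
  rw [← ENNReal.toReal_sum fun a _ => p.apply_ne_top a, ← tsum_fintype (L := .unconditional α),
    p.tsum_coe, ENNReal.toReal_one]

lemma pObs_nonneg {N : ℕ} (g : Bits N → Bool) (s : Profile N) (F : Protocol N) (i : Fin N)
    (bi mi : Bool) (f : Bits N) (val : Bool) : 0 ≤ pObs g s F i bi mi f val := by
  refine Finset.sum_nonneg fun b _ => Finset.sum_nonneg fun m _ => ?_
  split_ifs
  · exact mul_nonneg (mul_nonneg (by positivity) (msgP_nonneg _ _ _)) ENNReal.toReal_nonneg
  · rfl

lemma sum_pObs_reply {N : ℕ} (g : Bits N → Bool) (s : Profile N) (F : Protocol N) (i : Fin N)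
    (bi mi val : Bool) :
    ∑ f, pObs g s F i bi mi f val = bitMass g i bi val * strandP (s i) bi mi := by
  unfold pObs bitMass
  rw [Finset.sum_comm, Finset.sum_mul]
  refine Finset.sum_congr rfl fun b _ => ?_
  rw [Finset.sum_comm]
  have hm : ∀ m : Bits N,
      (∑ f, if b i.succ = bi ∧ m i.succ = mi ∧ g b = val then jointP s F b m f else 0) =
        (if b i.succ = bi ∧ g b = val then ((1:ℝ)/2)^(N+1) else 0) *
          (if m i.succ = mi then msgP s b m else 0) := by
    intro m
    by_cases h : b i.succ = bi ∧ m i.succ = mi ∧ g b = val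
    · simp only [if_pos h, if_pos h.2.1, if_pos (And.intro h.1 h.2.2), jointP]
      rw [← Finset.mul_sum, PMF.sum_toReal, mul_one]
    · simp only [if_neg h, Finset.sum_const_zero]
      split_ifs <;> simp_all
  simp_rw [hm]
  rw [← Finset.mul_sum, sum_msgP_filter]
  split_ifs with h
  · rw [h.1]
  · simp

lemma sum_pObs {N : ℕ} (g : Bits N → Bool) (s : Profile N) (F : Protocol N) (i : Fin N)
    (bi val : Bool) : ∑ mi, ∑ f, pObs g s F i bi mi f val = bitMass g i bi val := by
  simp_rw [sum_pObs_reply]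
  rw [← Finset.mul_sum, sum_strandP, mul_one]

lemma sum_bitMass {N : ℕ} (g : Bits N → Bool) (i : Fin N) :
    ∑ bi, (bitMass g i bi true + bitMass g i bi false) = 1 := by
  have hb : ∀ b : Bits N, (∑ bi, ((if b i.succ = bi ∧ g b = true then ((1:ℝ)/2)^(N+1) else 0) +
      if b i.succ = bi ∧ g b = false then ((1:ℝ)/2)^(N+1) else 0)) = ((1:ℝ)/2)^(N+1) := by
    intro b
    cases g b <;> cases b i.succ <;> simp
  unfold bitMass
  simp_rw [← Finset.sum_add_distrib]
  rw [Finset.sum_comm]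
  simp_rw [hb]
  simp

lemma sum_pObs_add {N : ℕ} (g : Bits N → Bool) (s : Profile N) (F : Protocol N) (i : Fin N) :
    ∑ bi, ∑ mi, ∑ f, (pObs g s F i bi mi f true + pObs g s F i bi mi f false) = 1 := by
  simp_rw [Finset.sum_add_distrib, sum_pObs]
  rw [← Finset.sum_add_distrib, sum_bitMass]

/-- The expected profit is that of a maximum a posteriori guess. -/
lemma V_eq_sum_max {N : ℕ} (g : Bits N → Bool) (c : Fin N → ℝ) (s : Profile N) (F : Protocol N)
    (i : Fin N) :
    V g c s F i = c i * ∑ bi, ∑ mi, ∑ f,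
      max (pObs g s F i bi mi f true) (pObs g s F i bi mi f false) := by
  unfold V
  congr 1
  refine Finset.sum_congr rfl fun bi _ => Finset.sum_congr rfl fun mi _ =>
    Finset.sum_congr rfl fun f _ => ?_
  split_ifs with h₁ h₂
  · exact (max_eq_left h₁.le).symm
  · exact (max_eq_right h₂.le).symm
  · rw [le_antisymm (not_lt.1 h₁) (not_lt.1 h₂), max_self]
    ring

/-- No protocol earns an agent more than guessing `g(b)` with certainty. -/
lemma V_le {N : ℕ} (g : Bits N → Bool) (c : Fin N → ℝ) (s : Profile N) (F : Protocol N)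
    (i : Fin N) (hc : 0 ≤ c i) : V g c s F i ≤ c i := by
  rw [V_eq_sum_max]
  refine mul_le_of_le_one_right hc ?_
  rw [← sum_pObs_add g s F i]
  gcongr with bi _ mi _ f _
  exact max_le_add_of_nonneg (pObs_nonneg _ _ _ _ _ _ _ _) (pObs_nonneg _ _ _ _ _ _ _ _)

/-- An agent earns at least what guessing from her own bit alone earns. -/
lemma le_V {N : ℕ} (g : Bits N → Bool) (c : Fin N → ℝ) (s : Profile N) (F : Protocol N)
    (i : Fin N) (hc : 0 ≤ c i) :
    c i * ∑ bi, max (bitMass g i bi true) (bitMass g i bi false) ≤ V g c s F i := by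
  rw [V_eq_sum_max]
  refine mul_le_mul_of_nonneg_left (Finset.sum_le_sum fun bi _ => max_le ?_ ?_) hc
  · rw [← sum_pObs g s F i bi true]
    gcongr
    exact le_max_left _ _
  · rw [← sum_pObs g s F i bi false]
    gcongr
    exact le_max_right _ _

/-- Uniformly random replies earn an agent exactly what her own bit does. -/
lemma V_of_uniform {N : ℕ} (g : Bits N → Bool) (c : Fin N → ℝ) (s : Profile N)
    (F : Protocol N) (i : Fin N) (hF : ∀ m, F s m = PMF.uniformOfFintype (Bits N)) :
    V g c s F i = c i * ∑ bi, max (bitMass g i bi true) (bitMass g i bi false) := by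
  rw [V_eq_sum_max]
  congr 1
  refine Finset.sum_congr rfl fun bi _ => ?_
  have hconst : ∀ mi f val,
      pObs g s F i bi mi f val = pObs g s F i bi mi (fun _ => false) val := by
    intro mi f val
    simp [pObs, jointP, hF]
  have hmax : ∀ mi, (∑ f, max (pObs g s F i bi mi f true) (pObs g s F i bi mi f false)) =
      max (bitMass g i bi true) (bitMass g i bi false) * strandP (s i) bi mi := by
    intro mi
    rw [max_mul_of_nonneg _ _ (strandP_nonneg _ _ _), ← sum_pObs_reply g s F,
      ← sum_pObs_reply g s F]
    simp_rw [hconst mi]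
    simp only [Finset.sum_const, nsmul_eq_mul]
    rw [mul_max_of_nonneg _ _ (Nat.cast_nonneg _)]
  simp_rw [hmax]
  rw [← Finset.mul_sum, sum_strandP, mul_one]

/-- Under the truthful profile, the full message vector reveals `g(b)`. -/
lemma V_truthProfile_of_pure {N : ℕ} (g : Bits N → Bool) (c : Fin N → ℝ) (F : Protocol N)
    (i : Fin N) (hF : ∀ m, F (truthProfile N) m = PMF.pure m) :
    V g c (truthProfile N) F i = c i := by
  have hzero : ∀ bi mi f val, g f ≠ val → pObs g (truthProfile N) F i bi mi f val = 0 := by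
    intro bi mi f val hval
    refine Finset.sum_eq_zero fun b _ => Finset.sum_eq_zero fun m _ => ?_
    split_ifs with h
    · unfold jointP
      by_cases hmb : m = b
      · subst hmb
        have hfm : f ≠ m := fun hfm => hval (hfm ▸ h.2.2)
        simp [hF, PMF.pure_apply, hfm]
      · simp [msgP_truthProfile_of_ne hmb]
    · rfl
  rw [V_eq_sum_max]
  refine (congrArg (c i * ·) ?_).trans (mul_one _)
  rw [← sum_pObs_add g (truthProfile N) F i]
  refine Finset.sum_congr rfl fun bi _ => Finset.sum_congr rfl fun mi _ =>
    Finset.sum_congr rfl fun f _ => ?_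
  cases hf : g f
  · rw [hzero bi mi f true (by simp [hf]), zero_add, max_eq_right (pObs_nonneg _ _ _ _ _ _ _ _)]
  · rw [hzero bi mi f false (by simp [hf]), add_zero, max_eq_left (pObs_nonneg _ _ _ _ _ _ _ _)]

/-- An agent who alone deviates from the truth gets a random reply: some other agent remains,
whose relative price is maximal. -/
lemma Fc_update_truthProfile {N : ℕ} (hN : 2 ≤ N) (price : Fin N → Strategy → ℝ)
    (hpos : ∀ i, 0 < price i sT) (hmax : ∀ i s, price i s ≤ price i sT) (i : Fin N)
    {s' : Strategy} (hs' : s' ≠ sT) (m : Bits N) :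
    Fc price i (Function.update (truthProfile N) i s') m = PMF.uniformOfFintype (Bits N) := by
  have : Nontrivial (Fin N) := Fin.nontrivial_iff_two_le.2 hN
  obtain ⟨j, hj⟩ := exists_ne i
  unfold Fc
  rw [if_neg, if_neg]
  · intro h
    have hlt := h j hj
    rw [Function.update_of_ne hj, Function.update_self] at hlt
    have hone : priceR price j (truthProfile N j) = 1 := div_self (hpos j).ne'
    have hle : priceR price i s' ≤ 1 := (div_le_one (hpos i)).2 (hmax i s')
    linarith
  · intro h
    exact hs' (by simpa using h i)

/-- Optimality Theorem. -/
theorem optimality_theorem (N : ℕ) (hN : 2 ≤ N) (g : Bits N → Bool) (c : Fin N → ℝ)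
    (hc : ∀ i, 0 < c i)
    (price : Fin N → Strategy → ℝ)
    (hpriceCont : ∀ i, Continuous (price i))
    (hprice0 : ∀ i s, ZeroInfo s → price i s = 0)
    (hpricePos : ∀ i s, ¬ ZeroInfo s → 0 < price i s)
    (hpriceMax : ∀ i s, price i s ≤ price i sT)
    (h : ∃ A : Fin N → Protocol N, Equilibrium g c price (truthProfile N) A) :
    Equilibrium g c price (truthProfile N) (Fc price) := by
  obtain ⟨A, hA⟩ := h
  have hsT : ∀ i, 0 < price i sT := fun i => hpricePos i sT (by simp [ZeroInfo, sT])
  intro i s'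
  by_cases hs' : s' = sT
  · subst hs'
    exact (congrArg (U g c price · (Fc price i) i)
      (Function.update_eq_self i (truthProfile N))).le
  have hnonneg : 0 ≤ price i s' := by
    by_cases hz : ZeroInfo s'
    · exact (hprice0 i s' hz).ge
    · exact (hpricePos i s' hz).le
  have hr : price i (0, 0) = 0 := hprice0 i (0, 0) rfl
  have hdev := hA i (0, 0)
  have hle := V_le g c (truthProfile N) (A i) i (hc i).le
  have hge := le_V g c (Function.update (truthProfile N) i (0, 0)) (A i) i (hc i).le
  have htruth := V_truthProfile_of_pure g c (Fc price i) i fun m => by simp [Fc, truthProfile]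
  have hrandom := V_of_uniform g c (Function.update (truthProfile N) i s') (Fc price i) i
    (Fc_update_truthProfile hN price hsT hpriceMax i hs')
  simp only [U, Function.update_self] at hdev ⊢
  linarith

end
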